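/- Let d ≥ 2 and let λ ∈ ℝ^d satisfy λ_1 ≥ λ_2 ≥ … ≥ λ_d ≥ 0 and Σ_k λ_k = 1. Let S(λ) ⊂ ℝ^{d−1} be the set of points (y_1,…,y_{d−1}) such that, setting y_d = 1 − Σ_{k<d} y_k, one has y_1 ≥ y_2 ≥ … ≥ y_d ≥ 0 and Σ_{k=1}^m y_k ≤ Σ_{k=1}^m λ_k for every m = 1,…,d (i.e., y ≺ λ). Then the (d−1)-dimensional Lebesgue measure of S(λ) equals (1/(d!·(d−1)!)) · Σ_{π ∈ S_d} (Σ_{k=1}^d π(k)·λ_k − (d+1)/2)^{d−1} / Π_{k=1}^{d−1}(π(k) − π(k+1)), where the sum runs over all permutations π of {1,…,d}. (This is the source volume of a pure state with Schmidt/diagonal vector λ under LICC/LSICC; up to the constant factor √d coming from the embedding into the hyperplane Σ y_k = 1, it gives the source coherence C_s(λ) = 1 − Σ_{π∈S_d}(Σ_k π(k)λ_k − (d+1)/2)^{d−1}/Π_{k=1}^{d−1}(π(k)−π(k+1)).) -/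

import Mathlib

open MeasureTheory

/-- Extend `y ∈ ℝ^{d-1}` to a vector in `ℝ^d` whose last entry is
`1 - Σ_{k<d} y_k`, so that the total sum is `1`. -/
noncomputable def extendProb (n : ℕ) (y : Fin (n + 1) → ℝ) : Fin (n + 2) → ℝ :=
  Fin.snoc y (1 - ∑ j, y j)

/-- `u` is majorized by `v`: all partial sums of `u` are dominated by those of
`v` (for sorted vectors with equal total sum). -/
def MajorizedBy (n : ℕ) (u v : Fin (n + 2) → ℝ) : Prop :=
  ∀ m : ℕ, m ≤ n + 2 →
    ∑ k ∈ Finset.univ.filter (fun k : Fin (n + 2) => (k : ℕ) < m), u k ≤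
    ∑ k ∈ Finset.univ.filter (fun k : Fin (n + 2) => (k : ℕ) < m), v k

/-- The projected source set of a sorted probability vector `lam ∈ ℝ^d`:
all `y ∈ ℝ^{d-1}` whose extension is sorted, nonnegative and majorized by
`lam`. -/
noncomputable def sourceSet (n : ℕ) (lam : Fin (n + 2) → ℝ) :
    Set (Fin (n + 1) → ℝ) :=
  {y | Antitone (extendProb n y) ∧ (∀ i, 0 ≤ extendProb n y i) ∧
    MajorizedBy n (extendProb n y) lam}

/-- Insert the value `p` at position `j` of the sequence `u`. -/
def insertSeq (j : ℕ) (p : ℝ) (u : ℕ → ℝ) (i : ℕ) : ℝ :=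
  if i < j then u i else if i = j then p else u (i - 1)

/-- Replace the entries `a k`, `a (k + 1)` by the single entry `a k + a (k + 1) - t`. -/
def mergeSeq (a : ℕ → ℝ) (k : ℕ) (t : ℝ) (i : ℕ) : ℝ :=
  if i < k then a i else if i = k then a k + a (k + 1) - t else a (i + 1)

/-- The summand of the volume formula attached to the ordering `u` of the nodes. -/
noncomputable def volumeTerm (N : ℕ) (a u : ℕ → ℝ) (s : ℝ) : ℝ :=
  (∑ i ∈ Finset.range (N + 1), a i * u i + s) ^ N / ∏ i ∈ Finset.range N, (u i - u (i + 1))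

lemma sum_mergeSeq (a : ℕ → ℝ) (k : ℕ) (t : ℝ) (m : ℕ) :
    ∑ i ∈ Finset.range m, mergeSeq a k t i =
      if m ≤ k then ∑ i ∈ Finset.range m, a i else ∑ i ∈ Finset.range (m + 1), a i - t := by
  induction m with
  | zero => simp
  | succ m ih =>
    rw [Finset.sum_range_succ, ih, mergeSeq, Finset.sum_range_succ _ (m + 1)]
    rcases lt_trichotomy m k with h | h | h
    · rw [if_pos h.le, if_pos h, if_pos (Nat.succ_le_of_lt h), Finset.sum_range_succ]
    · subst h
      simp [Finset.sum_range_succ]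
      ring
    · rw [if_neg (by omega), if_neg (by omega), if_neg (by omega), if_neg (by omega)]
      ring

lemma antitone_mergeSeq {a : ℕ → ℝ} (ha : Antitone a) {k : ℕ} {t : ℝ}
    (h₁ : a (k + 1) ≤ t) (h₂ : t ≤ a k) : Antitone (mergeSeq a k t) := by
  refine antitone_nat_of_succ_le fun i => ?_
  have h := ha (Nat.le_succ i)
  have h' := ha (Nat.le_succ (i + 1))
  simp only [Nat.succ_eq_add_one] at h h'
  unfold mergeSeq
  rcases lt_trichotomy (i + 1) k with hi | hi | hi
  · rw [if_pos hi, if_pos (by omega)]; exact h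
  · subst hi
    rw [if_neg (by omega), if_pos rfl, if_pos (by omega)]; linarith
  · rw [if_neg (by omega), if_neg (by omega), if_neg (by omega)]
    split_ifs with hik
    · subst hik; linarith
    · exact h'

lemma sum_mergeSeq_mul (a u : ℕ → ℝ) (k : ℕ) (t : ℝ) {N : ℕ} (hk : k < N) :
    ∑ i ∈ Finset.range N, mergeSeq a k t i * u i =
      ∑ i ∈ Finset.range N, mergeSeq a k 0 i * u i - t * u k := by
  have h : ∀ i ∈ Finset.range N, mergeSeq a k t i * u i =
      mergeSeq a k 0 i * u i - if i = k then t * u k else 0 := by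
    intro i _
    unfold mergeSeq
    split_ifs with h₁ h₂ h₂
    · omega
    · ring
    · subst h₂; ring
    · ring
  rw [Finset.sum_congr rfl h, Finset.sum_sub_distrib, Finset.sum_ite_eq', if_pos (by simpa using hk)]

lemma sum_mergeSeq_left (a u : ℕ → ℝ) (p : ℝ) {k N : ℕ} (hk : k ≤ N) :
    ∑ i ∈ Finset.range (N + 1), mergeSeq a k (a k) i * u i + p * a k =
      ∑ i ∈ Finset.range (N + 2), a i * insertSeq k p u i := by
  induction N, hk using Nat.le_induction with
  | base =>
    rw [Finset.sum_range_succ, Finset.sum_range_succ _ (k + 1), Finset.sum_range_succ _ k]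
    have : ∀ i ∈ Finset.range k, mergeSeq a k (a k) i * u i = a i * insertSeq k p u i := by
      intro i hi
      rw [Finset.mem_range] at hi
      simp [mergeSeq, insertSeq, hi]
    rw [Finset.sum_congr rfl this]
    simp [mergeSeq, insertSeq]
    ring
  | succ N hN ih =>
    rw [Finset.sum_range_succ, Finset.sum_range_succ _ (N + 2), ← ih]
    simp only [mergeSeq, insertSeq]
    rw [if_neg (by omega), if_neg (by omega), if_neg (by omega), if_neg (by omega)]
    simp
    ring

lemma sum_mergeSeq_right (a u : ℕ → ℝ) (p : ℝ) {k N : ℕ} (hk : k ≤ N) :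
    ∑ i ∈ Finset.range (N + 1), mergeSeq a k (a (k + 1)) i * u i + p * a (k + 1) =
      ∑ i ∈ Finset.range (N + 2), a i * insertSeq (k + 1) p u i := by
  induction N, hk using Nat.le_induction with
  | base =>
    rw [Finset.sum_range_succ, Finset.sum_range_succ _ (k + 1), Finset.sum_range_succ _ k]
    have : ∀ i ∈ Finset.range k,
        mergeSeq a k (a (k + 1)) i * u i = a i * insertSeq (k + 1) p u i := by
      intro i hi
      rw [Finset.mem_range] at hi
      simp [mergeSeq, insertSeq, hi, hi.trans (Nat.lt_succ_self k)]
    rw [Finset.sum_congr rfl this]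
    simp [mergeSeq, insertSeq]
    ring
  | succ N hN ih =>
    rw [Finset.sum_range_succ, Finset.sum_range_succ _ (N + 2), ← ih]
    simp only [mergeSeq, insertSeq]
    rw [if_neg (by omega), if_neg (by omega), if_neg (by omega), if_neg (by omega)]
    simp
    ring

lemma integral_affine_pow (C c x y : ℝ) (hc : c ≠ 0) (N : ℕ) :
    ∫ t in x..y, (C + c * t) ^ N =
      ((C + c * y) ^ (N + 1) - (C + c * x) ^ (N + 1)) / ((N + 1) * c) := by
  have := intervalIntegral.integral_comp_add_mul (fun z : ℝ => z ^ N) hc C (a := x) (b := y)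
  rw [this, integral_pow, smul_eq_mul]
  field_simp

lemma prod_insertSeq (u : ℕ → ℝ) (p : ℝ) {N j : ℕ} (hj : j ≤ N + 1)
    (hp : ∀ i ≤ N, u i ≠ p) (hu : ∀ i < N, u i ≠ u (i + 1)) :
    (∏ i ∈ Finset.range (N + 1), (insertSeq j p u i - insertSeq j p u (i + 1)))⁻¹ =
      ((if j = 0 then 0 else (u (j - 1) - p)⁻¹) - if j = N + 1 then 0 else (u j - p)⁻¹) /
        ∏ i ∈ Finset.range N, (u i - u (i + 1)) := by
  rcases j with _ | j
  · rw [Finset.prod_range_succ']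
    simp only [insertSeq]
    simp only [not_lt_zero, if_false, if_true, Nat.succ_ne_zero, Nat.add_sub_cancel]
    rw [if_neg (by omega), mul_inv, div_eq_mul_inv, zero_sub, ← neg_sub (u 0) p, inv_neg]
    ring
  · have hpre : ∀ i ∈ Finset.range j,
        insertSeq (j + 1) p u i - insertSeq (j + 1) p u (i + 1) = u i - u (i + 1) := by
      intro i hi
      rw [Finset.mem_range] at hi
      simp [insertSeq, hi, hi.trans (Nat.lt_succ_self j)]
    rcases Nat.lt_or_ge j N with hjN | hjN
    · obtain ⟨b, rfl⟩ : ∃ b, N = j + 1 + b := ⟨N - (j + 1), by omega⟩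
      have h₁ : u j - p ≠ 0 := sub_ne_zero.2 (hp j (by omega))
      have h₂ : u (j + 1) - p ≠ 0 := sub_ne_zero.2 (hp (j + 1) (by omega))
      have h₃ : u j - u (j + 1) ≠ 0 := sub_ne_zero.2 (hu j (by omega))
      have hpost : ∀ i ∈ Finset.range b,
          insertSeq (j + 1) p u (j + 1 + 1 + i) - insertSeq (j + 1) p u (j + 1 + 1 + i + 1) =
            u (j + 1 + i) - u (j + 1 + i + 1) := by
        intro i _
        simp only [insertSeq]
        rw [if_neg (by omega), if_neg (by omega), if_neg (by omega), if_neg (by omega)]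
        congr 2 <;> omega
      rw [show j + 1 + b + 1 = j + 1 + 1 + b by ring, Finset.prod_range_add,
        Finset.prod_range_succ _ (j + 1), Finset.prod_range_succ _ j,
        Finset.prod_congr rfl hpre, Finset.prod_congr rfl hpost,
        Finset.prod_range_add _ (j + 1) b, Finset.prod_range_succ _ j, if_neg (by omega), if_neg (by omega)]
      have hA : ∏ i ∈ Finset.range j, (u i - u (i + 1)) ≠ 0 :=
        Finset.prod_ne_zero_iff.2 fun i hi =>
          sub_ne_zero.2 (hu i (by rw [Finset.mem_range] at hi; omega))
      have hB : ∏ i ∈ Finset.range b, (u (j + 1 + i) - u (j + 1 + i + 1)) ≠ 0 :=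
        Finset.prod_ne_zero_iff.2 fun i hi =>
          sub_ne_zero.2 (hu _ (by rw [Finset.mem_range] at hi; omega))
      have e₁ : insertSeq (j + 1) p u j = u j := by simp [insertSeq]
      have e₂ : insertSeq (j + 1) p u (j + 1) = p := by simp [insertSeq]
      have e₃ : insertSeq (j + 1) p u (j + 1 + 1) = u (j + 1) := by simp [insertSeq]
      have h₄ : p - u (j + 1) ≠ 0 := by rw [← neg_sub]; exact neg_ne_zero.2 h₂
      rw [e₁, e₂, e₃, Nat.add_sub_cancel]
      field_simp
      ring
    · obtain rfl : j = N := by omega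
      rw [Finset.prod_range_succ, Finset.prod_congr rfl hpre]
      simp [insertSeq]
      ring

/-- Integrating the terms of the `N`-dimensional formula over the slices produces the terms of the
`(N + 1)`-dimensional one. -/
lemma sum_integral_volumeTerm (a u : ℕ → ℝ) (p s : ℝ) {N : ℕ}
    (hp : ∀ i ≤ N, u i ≠ p) (hu : ∀ i < N, u i ≠ u (i + 1)) :
    ∑ k ∈ Finset.range (N + 1),
        ∫ t in a k..a (k + 1), volumeTerm N (mergeSeq a k t) u (p * t + s) =
      -(1 / ((N : ℝ) + 1)) * ∑ j ∈ Finset.range (N + 2),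
        volumeTerm (N + 1) a (insertSeq j p u) s := by
  set B : ℕ → ℝ := fun j =>
    (∑ i ∈ Finset.range (N + 2), a i * insertSeq j p u i + s) ^ (N + 1) with hB
  set D := ∏ i ∈ Finset.range N, (u i - u (i + 1)) with hD
  have hint : ∀ k ∈ Finset.range (N + 1),
      ∫ t in a k..a (k + 1), volumeTerm N (mergeSeq a k t) u (p * t + s) =
        -(1 / ((N : ℝ) + 1)) * (((u k - p)⁻¹ * B (k + 1) - (u k - p)⁻¹ * B k) / D) := by
    intro k hk
    rw [Finset.mem_range] at hk
    have hc : p - u k ≠ 0 := sub_ne_zero.2 (hp k (by omega)).symm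
    have hform : ∀ t, ∑ i ∈ Finset.range (N + 1), mergeSeq a k t i * u i + (p * t + s) =
        (∑ i ∈ Finset.range (N + 1), mergeSeq a k 0 i * u i + s) + (p - u k) * t := by
      intro t
      rw [sum_mergeSeq_mul a u k t hk]
      ring
    have hL := sum_mergeSeq_left a u p (Nat.lt_succ_iff.1 hk)
    have hR := sum_mergeSeq_right a u p (Nat.lt_succ_iff.1 hk)
    simp only [volumeTerm]
    rw [intervalIntegral.integral_div]
    simp only [hform]
    rw [integral_affine_pow _ _ _ _ hc, ← hform, ← hform, ← add_assoc, ← add_assoc, hL, hR,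
      ← hD, show u k - p = -(p - u k) by ring, inv_neg]
    simp only [hB]
    field_simp
    ring
  have hterm : ∀ j ∈ Finset.range (N + 2), volumeTerm (N + 1) a (insertSeq j p u) s =
      (if j = 0 then 0 else (u (j - 1) - p)⁻¹ * B j / D) -
        if j = N + 1 then 0 else (u j - p)⁻¹ * B j / D := by
    intro j hj
    rw [Finset.mem_range] at hj
    rw [volumeTerm, div_eq_mul_inv, prod_insertSeq u p (Nat.lt_succ_iff.1 hj) hp hu]
    simp only [hB]
    split_ifs <;> ring
  rw [Finset.sum_congr rfl hint, Finset.sum_congr rfl hterm, ← Finset.mul_sum,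
    Finset.sum_sub_distrib, Finset.sum_range_succ' _ (N + 1),
    Finset.sum_range_succ (fun j => if j = N + 1 then 0 else (u j - p)⁻¹ * B j / D) (N + 1)]
  congr 1
  simp only [sub_div, Finset.sum_sub_distrib]
  simp only [Nat.succ_ne_zero, if_false, if_true, add_zero, Nat.add_sub_cancel]
  congr 1
  refine Finset.sum_congr rfl fun k hk => ?_
  rw [if_neg (Finset.mem_range.1 hk).ne]

/-- Complete `y` to a vector with one more entry and total sum `s`. -/
def completion {N : ℕ} (s : ℝ) (y : Fin N → ℝ) : Fin (N + 1) → ℝ :=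
  Fin.snoc y (s - ∑ j, y j)

/-- The permutohedron of `(a 0, …, a N)`, projected to its first `N` coordinates. -/
def permutohedron (N : ℕ) (a : ℕ → ℝ) : Set (Fin N → ℝ) :=
  {y | ∀ I : Finset (Fin (N + 1)),
    ∑ i ∈ I, completion (∑ i ∈ Finset.range (N + 1), a i) y i ≤ ∑ i ∈ Finset.range I.card, a i}

lemma sum_completion {N : ℕ} (s : ℝ) (y : Fin N → ℝ) : ∑ i, completion s y i = s := by
  rw [completion, Fin.sum_snoc]
  ring

lemma completion_cons {N : ℕ} (s t : ℝ) (y : Fin N → ℝ) :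
    completion s (Fin.cons t y : Fin (N + 1) → ℝ) = Fin.cons t (completion (s - t) y) := by
  rw [completion, completion, Fin.cons_snoc_eq_snoc_cons, Fin.sum_cons, sub_sub]

lemma continuous_completion {N : ℕ} (s : ℝ) :
    Continuous (completion s : (Fin N → ℝ) → Fin (N + 1) → ℝ) := by
  refine continuous_pi fun i => ?_
  refine Fin.lastCases ?_ (fun j => ?_) i
  · simp only [completion, Fin.snoc_last]
    fun_prop
  · simp only [completion, Fin.snoc_castSucc]
    fun_prop

lemma isClosed_permutohedron (N : ℕ) (a : ℕ → ℝ) : IsClosed (permutohedron N a) := by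
  simp only [permutohedron, Set.ofPred_forall]
  refine isClosed_iInter fun I => isClosed_le ?_ continuous_const
  exact continuous_finsetSum _ fun i _ => (continuous_apply i).comp (continuous_completion _)

lemma completion_mem_Icc {N : ℕ} {a : ℕ → ℝ} {y : Fin N → ℝ} (hy : y ∈ permutohedron N a)
    (i : Fin (N + 1)) :
    completion (∑ i ∈ Finset.range (N + 1), a i) y i ∈ Set.Icc (a N) (a 0) := by
  constructor
  · have h := hy {i}ᶜ
    have h' := Finset.sum_add_sum_compl {i} (completion (∑ i ∈ Finset.range (N + 1), a i) y)
    rw [sum_completion, Finset.sum_singleton, Finset.sum_range_succ] at h'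
    rw [Finset.card_compl, Finset.card_singleton, Fintype.card_fin, Nat.add_sub_cancel] at h
    rw [Finset.sum_range_succ] at h ⊢
    linarith
  · simpa using hy {i}

lemma volume_permutohedron_ne_top (N : ℕ) (a : ℕ → ℝ) : volume (permutohedron N a) ≠ ⊤ := by
  refine ((measure_mono (t := Set.Icc (fun _ => a N) (fun _ => a 0)) fun y hy => ?_).trans_lt
    measure_Icc_lt_top).ne
  have h := fun i : Fin N => completion_mem_Icc hy i.castSucc
  simp only [completion, Fin.snoc_castSucc] at h
  exact ⟨fun i => (h i).1, fun i => (h i).2⟩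

lemma cons_mem_permutohedron {N : ℕ} {a : ℕ → ℝ} (ha : Antitone a) {k : ℕ} (hk : k ≤ N) {t : ℝ}
    (h₁ : a (k + 1) ≤ t) (h₂ : t ≤ a k) (y : Fin N → ℝ) :
    (Fin.cons t y : Fin (N + 1) → ℝ) ∈ permutohedron (N + 1) a ↔
      y ∈ permutohedron N (mergeSeq a k t) := by
  have hs : ∑ i ∈ Finset.range (N + 1), mergeSeq a k t i =
      ∑ i ∈ Finset.range (N + 1 + 1), a i - t := by
    rw [sum_mergeSeq, if_neg (by omega)]
  simp only [permutohedron, Set.mem_ofPred_eq, hs, completion_cons]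
  set z := completion (∑ i ∈ Finset.range (N + 1 + 1), a i - t) y
  constructor
  · intro h I
    rw [sum_mergeSeq]
    split_ifs with hI
    · simpa using h (I.map (Fin.succEmb _))
    · have := h (Finset.cons 0 (I.map (Fin.succEmb _)) (by simp))
      simp only [Finset.sum_cons, Finset.sum_map, Finset.card_cons, Finset.card_map,
        Fin.coe_succEmb, Fin.cons_zero, Fin.cons_succ] at this
      linarith
  · intro h I
    have hI := h (Finset.univ.filter fun i => i.succ ∈ I)
    have hsum : ∑ i ∈ I, (Fin.cons t z : Fin (N + 2) → ℝ) i =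
        (if 0 ∈ I then t else 0) + ∑ i ∈ Finset.univ.filter (fun i => Fin.succ i ∈ I), z i := by
      rw [Finset.sum_filter, ← Finset.univ_inter I, ← Finset.sum_ite_mem, Fin.sum_univ_succ]
      simp
    have hcard : I.card = (if 0 ∈ I then 1 else 0) +
        (Finset.univ.filter fun i => Fin.succ i ∈ I).card := by
      rw [Finset.card_filter, Finset.card_eq_sum_ones, ← Finset.univ_inter I,
        ← Finset.sum_ite_mem, Fin.sum_univ_succ]
      simp
    rw [hsum, hcard]
    set m := (Finset.univ.filter fun i => Fin.succ i ∈ I).card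
    rw [sum_mergeSeq] at hI
    split_ifs with h0
    · rw [add_comm 1 m]
      split_ifs at hI with hm
      · rw [Finset.sum_range_succ]
        have := ha hm
        linarith
      · linarith
    · rw [zero_add, zero_add]
      split_ifs at hI with hm
      · exact hI
      · rw [Finset.sum_range_succ] at hI
        have : a m ≤ a (k + 1) := ha (by omega)
        linarith

lemma volume_permutohedron_succ (N : ℕ) (a : ℕ → ℝ) (ha : Antitone a) :
    volume.real (permutohedron (N + 1) a) =
      ∫ t in a (N + 1)..a 0,
        volume.real {y : Fin N → ℝ | (Fin.cons t y : Fin (N + 1) → ℝ) ∈ permutohedron (N + 1) a} := by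
  set P := permutohedron (N + 1) a with hP
  have hmeas : MeasurableSet P := (isClosed_permutohedron (N + 1) a).measurableSet
  set e := MeasurableEquiv.piFinSuccAbove (fun _ : Fin (N + 1) => ℝ) 0 with he
  have hmp := (volume_preserving_piFinSuccAbove (fun _ : Fin (N + 1) => ℝ) 0).symm e
  have hslice : ∀ t, Prod.mk t ⁻¹' (e.symm ⁻¹' P) =
      {y : Fin N → ℝ | (Fin.cons t y : Fin (N + 1) → ℝ) ∈ P} := by
    intro t
    ext y
    simp [he, MeasurableEquiv.piFinSuccAbove, Fin.insertNthEquiv]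
  have hvol : volume P =
      ∫⁻ t, volume {y : Fin N → ℝ | (Fin.cons t y : Fin (N + 1) → ℝ) ∈ P} := by
    rw [← hmp.measure_preimage hmeas.nullMeasurableSet, Measure.volume_eq_prod,
      Measure.prod_apply (e.symm.measurable hmeas)]
    exact lintegral_congr fun t => by rw [← hslice]
  have hm : Measurable fun t =>
      volume {y : Fin N → ℝ | (Fin.cons t y : Fin (N + 1) → ℝ) ∈ P} := by
    have := measurable_measure_prodMk_left (ν := (volume : Measure (Fin N → ℝ)))
      (e.symm.measurable hmeas)
    simp only [hslice] at this
    exact this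
  have hreal : volume.real P =
      ∫ t, volume.real {y : Fin N → ℝ | (Fin.cons t y : Fin (N + 1) → ℝ) ∈ P} := by
    simp only [measureReal_def]
    rw [hvol, integral_toReal hm.aemeasurable]
    refine ae_lt_top hm ?_
    rw [← hvol]
    exact volume_permutohedron_ne_top (N + 1) a
  rw [hreal, intervalIntegral.integral_of_le (ha (Nat.zero_le _)), ← integral_Icc_eq_integral_Ioc,
    setIntegral_eq_integral_of_forall_compl_eq_zero]
  intro t ht
  have : {y : Fin N → ℝ | (Fin.cons t y : Fin (N + 1) → ℝ) ∈ P} = ∅ := by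
    refine Set.eq_empty_of_forall_notMem fun y hy => ht ?_
    have := completion_mem_Icc hy 0
    rwa [completion_cons, Fin.cons_zero] at this
  simp [this]

/-- Extend a finite sequence by zero. -/
def extendSeq {d : ℕ} (v : Fin d → ℝ) (i : ℕ) : ℝ := if h : i < d then v ⟨i, h⟩ else 0

lemma extendSeq_coe {d : ℕ} (v : Fin d → ℝ) (i : Fin d) : extendSeq v i = v i := by
  simp [extendSeq]

lemma volumeTerm_congr {N : ℕ} {a u v : ℕ → ℝ} (s : ℝ) (h : ∀ i ≤ N, u i = v i) :
    volumeTerm N a u s = volumeTerm N a v s := by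
  unfold volumeTerm
  congr 1
  · congr 2
    exact Finset.sum_congr rfl fun i hi => by
      rw [h i (Nat.lt_succ_iff.1 (Finset.mem_range.1 hi))]
  · refine Finset.prod_congr rfl fun i hi => ?_
    rw [Finset.mem_range] at hi
    rw [h i hi.le, h (i + 1) hi]

/-- The permutation sending `j` to `0` and otherwise following `w`. -/
def insertPerm {d : ℕ} (q : Fin (d + 1) × Equiv.Perm (Fin d)) : Equiv.Perm (Fin (d + 1)) :=
  ((finSuccEquiv' q.1).trans q.2.optionCongr).trans (finSuccEquiv' 0).symm

lemma insertPerm_at {d : ℕ} (j : Fin (d + 1)) (w : Equiv.Perm (Fin d)) :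
    insertPerm (j, w) j = 0 := by
  simp [insertPerm]

lemma insertPerm_succAbove {d : ℕ} (j : Fin (d + 1)) (w : Equiv.Perm (Fin d)) (i : Fin d) :
    insertPerm (j, w) (j.succAbove i) = (w i).succ := by
  simp [insertPerm]

lemma insertPerm_bijective (d : ℕ) : Function.Bijective (insertPerm (d := d)) := by
  rw [Fintype.bijective_iff_injective_and_card]
  constructor
  · rintro ⟨j, w⟩ ⟨j', w'⟩ h
    have hj : j = j' := by
      have h₁ := insertPerm_at j w
      rw [h, ← insertPerm_at j' w'] at h₁
      exact (insertPerm (j', w')).injective h₁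
    subst hj
    have hw : w = w' := by
      ext i
      have := insertPerm_succAbove j w i
      rw [h, insertPerm_succAbove] at this
      rw [Fin.succ_injective _ this]
    rw [hw]
  · simp [Fintype.card_perm, Nat.factorial_succ]

lemma extendSeq_insertPerm {d : ℕ} (x : Fin (d + 1) → ℝ) (j : Fin (d + 1))
    (w : Equiv.Perm (Fin d)) (i : ℕ) (hi : i < d + 1) :
    extendSeq (x ∘ insertPerm (j, w)) i =
      insertSeq j (x 0) (extendSeq (fun l => x (w l).succ)) i := by
  obtain ⟨i, rfl⟩ : ∃ i' : Fin (d + 1), (i' : ℕ) = i := ⟨⟨i, hi⟩, rfl⟩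
  rw [extendSeq_coe, Function.comp_apply]
  rcases Fin.eq_self_or_eq_succAbove j i with rfl | ⟨l, rfl⟩
  · simp [insertPerm_at, insertSeq]
  · rw [insertPerm_succAbove]
    rcases Fin.castSucc_lt_or_lt_succ j l with h | h
    · rw [Fin.succAbove_of_castSucc_lt _ _ h, insertSeq, if_pos (by exact h), Fin.val_castSucc,
        extendSeq_coe]
    · rw [Fin.succAbove_of_lt_succ _ _ h, insertSeq]
      have h' : (j : ℕ) < (l : ℕ) + 1 := h
      rw [Fin.val_succ, if_neg (by omega), if_neg (by omega), Nat.add_sub_cancel, extendSeq_coe]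

/-- Volume of the permutohedron, for arbitrary distinct nodes `x` and an arbitrary shift `s`. -/
theorem volume_permutohedron (N : ℕ) (a : ℕ → ℝ) (ha : Antitone a) (x : Fin (N + 1) → ℝ)
    (hx : Function.Injective x) (s : ℝ) :
    volume.real (permutohedron N a) =
      1 / (N.factorial : ℝ) *
        ∑ w : Equiv.Perm (Fin (N + 1)), volumeTerm N a (extendSeq (x ∘ w)) s := by
  induction N generalizing a s with
  | zero =>
    have : permutohedron 0 a = Set.univ := by
      refine Set.eq_univ_of_forall fun y I => ?_
      rcases Finset.eq_empty_or_nonempty I with rfl | ⟨i, hi⟩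
      · simp
      · obtain rfl : I = Finset.univ :=
          Finset.eq_univ_of_forall fun j => by rwa [Fin.subsingleton_one.elim j i]
        rw [sum_completion, Finset.card_univ, Fintype.card_fin]
    simp [this, volumeTerm, measureReal_def, volume_pi]
  | succ N ih =>
    set x' : Fin (N + 1) → ℝ := fun l => x l.succ with hx'
    have hx'inj : Function.Injective x' := fun i j h => Fin.succ_injective _ (hx h)
    set g : ℕ → ℝ → ℝ := fun k t => 1 / (N.factorial : ℝ) *
      ∑ w : Equiv.Perm (Fin (N + 1)),
        volumeTerm N (mergeSeq a k t) (extendSeq (x' ∘ w)) (x 0 * t + s) with hg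
    set f : ℝ → ℝ := fun t =>
      volume.real {y : Fin N → ℝ | (Fin.cons t y : Fin (N + 1) → ℝ) ∈ permutohedron (N + 1) a}
      with hf
    have hterm : ∀ (k : ℕ) (w : Equiv.Perm (Fin (N + 1))),
        Continuous fun t => volumeTerm N (mergeSeq a k t) (extendSeq (x' ∘ w)) (x 0 * t + s) := by
      intro k w
      have hmerge : ∀ i, Continuous fun t => mergeSeq a k t i := by
        intro i
        unfold mergeSeq
        split_ifs <;> fun_prop
      unfold volumeTerm
      fun_prop
    have hcont : ∀ k, Continuous (g k) := fun k =>
      continuous_const.mul (continuous_finsetSum _ fun w _ => hterm k w)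
    have hfg : ∀ k < N + 1, Set.EqOn (g k) f (Set.uIcc (a k) (a (k + 1))) := by
      intro k hk t ht
      rw [Set.uIcc_of_ge (ha (Nat.le_succ k))] at ht
      have hset : {y : Fin N → ℝ | (Fin.cons t y : Fin (N + 1) → ℝ) ∈ permutohedron (N + 1) a} =
          permutohedron N (mergeSeq a k t) :=
        Set.ext fun y => cons_mem_permutohedron ha (Nat.lt_succ_iff.1 hk) ht.1 ht.2 y
      simp only [hf, hg, hset]
      rw [ih _ (antitone_mergeSeq ha ht.1 ht.2) x' hx'inj]
    have hsum : ∑ k ∈ Finset.range (N + 1), ∫ t in a k..a (k + 1), g k t =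
        ∫ t in a 0..a (N + 1), f t := by
      rw [← intervalIntegral.sum_integral_adjacent_intervals]
      · exact Finset.sum_congr rfl fun k hk =>
          intervalIntegral.integral_congr (hfg k (Finset.mem_range.1 hk))
      · intro k hk
        exact ((hcont k).intervalIntegrable _ _).congr
          ((hfg k hk).mono Set.uIoc_subset_uIcc)
    rw [volume_permutohedron_succ N a ha, intervalIntegral.integral_symm, ← hsum]
    have hint : ∀ k, ∫ t in a k..a (k + 1), g k t = 1 / (N.factorial : ℝ) *
        ∑ w : Equiv.Perm (Fin (N + 1)), ∫ t in a k..a (k + 1),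
          volumeTerm N (mergeSeq a k t) (extendSeq (x' ∘ w)) (x 0 * t + s) := by
      intro k
      simp only [hg]
      rw [intervalIntegral.integral_const_mul, intervalIntegral.integral_finsetSum]
      exact fun w _ => (hterm k w).intervalIntegrable _ _
    simp only [hint]
    rw [← Finset.mul_sum, Finset.sum_comm,
      ← Function.Bijective.sum_comp (insertPerm_bijective (N + 1))
        (fun w => volumeTerm (N + 1) a (extendSeq (x ∘ w)) s),
      Fintype.sum_prod_type_right]
    have hfix : ∀ w : Equiv.Perm (Fin (N + 1)),
        ∑ k ∈ Finset.range (N + 1), ∫ t in a k..a (k + 1),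
          volumeTerm N (mergeSeq a k t) (extendSeq (x' ∘ w)) (x 0 * t + s) =
        -(1 / ((N : ℝ) + 1)) * ∑ j : Fin (N + 2),
          volumeTerm (N + 1) a (extendSeq (x ∘ insertPerm (j, w))) s := by
      intro w
      rw [sum_integral_volumeTerm, Finset.sum_range]
      · congr 1
        refine Finset.sum_congr rfl fun j _ => ?_
        exact (volumeTerm_congr s fun i hi =>
          extendSeq_insertPerm x j w i (Nat.lt_succ_of_le hi)).symm
      · intro i hi
        simp only [extendSeq, dif_pos (Nat.lt_succ_of_le hi), Function.comp_apply, hx']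
        exact fun h => Fin.succ_ne_zero _ (hx h)
      · intro i hi
        simp only [extendSeq, dif_pos (Nat.succ_lt_succ hi),
          dif_pos (hi.trans (Nat.lt_succ_self N)), Function.comp_apply]
        exact fun h => by simpa using w.injective (hx'inj h)
    rw [Finset.sum_congr rfl fun w _ => hfix w, ← Finset.mul_sum, Nat.factorial_succ]
    push_cast
    field_simp

lemma completion_comp_castSucc {N : ℕ} {s : ℝ} {z : Fin (N + 1) → ℝ} (hz : ∑ i, z i = s) :
    completion s (fun i : Fin N => z i.castSucc) = z := by
  rw [Fin.sum_univ_castSucc] at hz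
  ext i
  refine Fin.lastCases ?_ (fun j => ?_) i
  · rw [completion, Fin.snoc_last]
    linarith
  · rw [completion, Fin.snoc_castSucc]

lemma completion_affine {N : ℕ} (s c : ℝ) (p q r : Fin N → ℝ) :
    completion s (c • (p - q) + r) =
      c • (completion s p - completion s q) + completion s r := by
  ext i
  refine Fin.lastCases ?_ (fun j => ?_) i
  · simp [completion, Finset.sum_add_distrib, ← Finset.mul_sum]
    ring
  · simp [completion]

/-- The action of a permutation on completed vectors, read on the first `N` coordinates. -/
def permCoord {N : ℕ} (σ : Equiv.Perm (Fin (N + 1))) (s : ℝ) (y : Fin N → ℝ) : Fin N → ℝ :=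
  fun i => completion s y (σ i.castSucc)

lemma completion_permCoord {N : ℕ} (σ : Equiv.Perm (Fin (N + 1))) (s : ℝ) (y : Fin N → ℝ) :
    completion s (permCoord σ s y) = completion s y ∘ σ := by
  refine completion_comp_castSucc (z := completion s y ∘ σ) ?_
  simp only [Function.comp_apply]
  rw [Equiv.sum_comp, sum_completion]

lemma continuous_permCoord {N : ℕ} (σ : Equiv.Perm (Fin (N + 1))) (s : ℝ) :
    Continuous (permCoord σ s) :=
  continuous_pi fun i => (continuous_apply (σ i.castSucc)).comp (continuous_completion s)

lemma completion_zero_add {N : ℕ} (s : ℝ) (y z : Fin N → ℝ) :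
    completion s (y + z) = completion 0 y + completion s z := by
  ext i
  refine Fin.lastCases ?_ (fun j => ?_) i
  · simp [completion, Finset.sum_add_distrib]
    ring
  · simp [completion]

lemma completion_zero_smul {N : ℕ} (c : ℝ) (y : Fin N → ℝ) :
    completion 0 (c • y) = c • completion 0 y := by
  ext i
  refine Fin.lastCases ?_ (fun j => ?_) i
  · simp [completion, ← Finset.mul_sum]
  · simp [completion]

/-- The linear part of `permCoord`. -/
def permCoordLinear {N : ℕ} (σ : Equiv.Perm (Fin (N + 1))) : (Fin N → ℝ) →ₗ[ℝ] (Fin N → ℝ) where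
  toFun := permCoord σ 0
  map_add' y z := by
    ext i
    simp [permCoord, completion_zero_add]
  map_smul' c y := by
    ext i
    simp [permCoord, completion_zero_smul]

lemma permCoordLinear_mul {N : ℕ} (σ τ : Equiv.Perm (Fin (N + 1))) :
    permCoordLinear (σ * τ) = permCoordLinear τ * permCoordLinear σ := by
  refine LinearMap.ext fun y => funext fun i => ?_
  change completion 0 y (σ (τ i.castSucc)) = completion 0 (permCoord σ 0 y) (τ i.castSucc)
  rw [completion_permCoord, Function.comp_apply]

lemma permCoordLinear_one {N : ℕ} :
    permCoordLinear (1 : Equiv.Perm (Fin (N + 1))) = 1 := by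
  refine LinearMap.ext fun y => funext fun i => ?_
  simp [permCoordLinear, permCoord, completion]

lemma permCoordLinear_pow {N : ℕ} (σ : Equiv.Perm (Fin (N + 1))) (k : ℕ) :
    permCoordLinear (σ ^ k) = permCoordLinear σ ^ k := by
  induction k with
  | zero => rw [pow_zero, pow_zero, permCoordLinear_one]
  | succ k ih => rw [pow_succ, permCoordLinear_mul, ih, pow_succ']

lemma abs_det_permCoordLinear {N : ℕ} (σ : Equiv.Perm (Fin (N + 1))) :
    |LinearMap.det (permCoordLinear σ)| = 1 := by
  have h : LinearMap.det (permCoordLinear σ) ^ orderOf σ = 1 := by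
    rw [← map_pow, ← permCoordLinear_pow, pow_orderOf_eq_one, permCoordLinear_one, map_one]
  refine (pow_eq_one_iff_of_nonneg (abs_nonneg _) (orderOf_pos σ).ne').1 ?_
  rw [← abs_pow, h, abs_one]

lemma volume_preimage_permCoord {N : ℕ} (σ : Equiv.Perm (Fin (N + 1))) (s : ℝ)
    (A : Set (Fin N → ℝ)) : volume (permCoord σ s ⁻¹' A) = volume A := by
  have hdet := abs_det_permCoordLinear σ
  have hset : permCoord σ s ⁻¹' A =
      permCoordLinear σ ⁻¹' ((fun y => y + permCoord σ s 0) ⁻¹' A) := by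
    ext y
    have : permCoord σ s y = permCoordLinear σ y + permCoord σ s 0 := by
      ext i
      have := completion_zero_add s y 0
      rw [add_zero] at this
      simp [permCoordLinear, permCoord, this]
    simp [this]
  rw [hset, Measure.addHaar_preimage_linearMap _ (fun h => by simp [h] at hdet), abs_inv, hdet,
    measure_preimage_add_right]
  simp

lemma volume_completion_eq_completion {N : ℕ} (s : ℝ) {i j : Fin (N + 1)} (hij : i ≠ j) :
    volume {y : Fin N → ℝ | completion s y i = completion s y j} = 0 := by
  let H : AffineSubspace ℝ (Fin N → ℝ) :=
    { carrier := {y | completion s y i = completion s y j}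
      smul_vsub_vadd_mem' := by
        intro c p q r hp hq hr
        simp only [Set.mem_ofPred_eq] at hp hq hr ⊢
        simp only [vsub_eq_sub, vadd_eq_add, completion_affine, Pi.add_apply, Pi.smul_apply,
          Pi.sub_apply, hp, hq, hr] }
  refine Measure.addHaar_affineSubspace volume H fun htop => ?_
  set z : Fin (N + 1) → ℝ :=
    fun l => s / (N + 1) + (if l = i then 1 else 0) - (if l = j then 1 else 0) with hz
  have hsum : ∑ l, z l = s := by
    simp [hz, Finset.sum_add_distrib, Finset.sum_sub_distrib]
    field_simp
  have hmem : (fun l : Fin N => z l.castSucc) ∈ H := htop ▸ AffineSubspace.mem_top ℝ _ _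
  have hmem' : completion s (fun l : Fin N => z l.castSucc) i =
    completion s (fun l : Fin N => z l.castSucc) j := hmem
  rw [completion_comp_castSucc hsum] at hmem'
  simp [hz, hij, hij.symm] at hmem'
  linarith

/-- The part of the permutohedron in the dominant chamber. -/
def sortedPart (N : ℕ) (a : ℕ → ℝ) : Set (Fin N → ℝ) :=
  permutohedron N a ∩ {y | Antitone (completion (∑ i ∈ Finset.range (N + 1), a i) y)}

lemma isClosed_sortedPart (N : ℕ) (a : ℕ → ℝ) : IsClosed (sortedPart N a) :=
  (isClosed_permutohedron N a).inter (isClosed_antitone.preimage (continuous_completion _))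

lemma permCoord_mem_permutohedron {N : ℕ} {a : ℕ → ℝ} (σ : Equiv.Perm (Fin (N + 1)))
    (y : Fin N → ℝ) :
    permCoord σ (∑ i ∈ Finset.range (N + 1), a i) y ∈ permutohedron N a ↔
      y ∈ permutohedron N a := by
  simp only [permutohedron, Set.mem_ofPred_eq, completion_permCoord]
  constructor
  · intro h I
    simpa using h (I.map σ.symm.toEmbedding)
  · intro h I
    simpa using h (I.map σ.toEmbedding)

lemma permutohedron_eq_iUnion (N : ℕ) (a : ℕ → ℝ) :
    permutohedron N a = ⋃ σ : Equiv.Perm (Fin (N + 1)),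
      permCoord σ (∑ i ∈ Finset.range (N + 1), a i) ⁻¹' sortedPart N a := by
  ext y
  simp only [Set.mem_iUnion, Set.mem_preimage, sortedPart, Set.mem_inter_iff,
    permCoord_mem_permutohedron, Set.mem_ofPred_eq, completion_permCoord]
  refine ⟨fun h => ?_, fun ⟨σ, h, _⟩ => h⟩
  set c := completion (∑ i ∈ Finset.range (N + 1), a i) y
  refine ⟨Tuple.sort (fun i => -c i), h, fun i j hij => ?_⟩
  simpa using Tuple.monotone_sort (fun i => -c i) hij

lemma volume_permutohedron_eq_sortedPart (N : ℕ) (a : ℕ → ℝ) :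
    volume (permutohedron N a) = ((N + 1).factorial : ENNReal) * volume (sortedPart N a) := by
  set s := ∑ i ∈ Finset.range (N + 1), a i with hs
  rw [permutohedron_eq_iUnion, measure_iUnion₀]
  · simp only [volume_preimage_permCoord]
    rw [tsum_fintype, Finset.sum_const, Finset.card_univ, Fintype.card_perm, Fintype.card_fin,
      nsmul_eq_mul]
  · intro σ τ hστ
    have hnull : volume (⋃ i : Fin (N + 1), ⋃ j : Fin (N + 1), ⋃ _ : i ≠ j,
        {y : Fin N → ℝ | completion s y i = completion s y j}) = 0 := by
      simp only [measure_iUnion_null_iff]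
      exact fun i j hij => volume_completion_eq_completion s hij
    refine measure_mono_null ?_ hnull
    rintro y ⟨hσ, hτ⟩
    have hσ' : Antitone (completion s y ∘ σ) := by
      rw [← completion_permCoord]; exact hσ.2
    have hτ' : Antitone (completion s y ∘ τ) := by
      rw [← completion_permCoord]; exact hτ.2
    have heq := Tuple.unique_antitone hσ' hτ'
    obtain ⟨i, hi⟩ : ∃ i, σ i ≠ τ i := by
      by_contra! h
      exact hστ (Equiv.ext h)
    simp only [Set.mem_iUnion]
    exact ⟨σ i, τ i, hi, congrFun heq i⟩
  · intro σ
    exact ((isClosed_sortedPart N a).preimage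
      (continuous_permCoord σ s)).measurableSet.nullMeasurableSet

lemma sum_filter_lt_eq_sum_range {d m : ℕ} (hm : m ≤ d) {z : Fin d → ℝ} {a : ℕ → ℝ}
    (h : ∀ k : Fin d, a k = z k) :
    ∑ k ∈ Finset.univ.filter (fun k : Fin d => (k : ℕ) < m), z k = ∑ i ∈ Finset.range m, a i := by
  rw [Finset.sum_filter]
  simp only [← h]
  rw [← Finset.sum_range (fun i => if i < m then a i else 0), ← Finset.sum_filter]
  refine Finset.sum_congr ?_ fun _ _ => rfl
  ext i
  simp only [Finset.mem_filter, Finset.mem_range]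
  omega

lemma Fin.val_le_of_strictMono {m d : ℕ} {f : Fin m → Fin d} (hf : StrictMono f) (i : Fin m) :
    (i : ℕ) ≤ f i := by
  obtain ⟨i, hi⟩ := i
  induction i with
  | zero => exact Nat.zero_le _
  | succ i ih =>
    have h₁ := ih (Nat.lt_of_succ_lt hi)
    have h₂ : f ⟨i, Nat.lt_of_succ_lt hi⟩ < f ⟨i + 1, hi⟩ := hf (Nat.lt_succ_self i)
    exact Nat.succ_le_of_lt (lt_of_le_of_lt h₁ h₂)

lemma sum_le_sum_filter_of_antitone {d : ℕ} {z : Fin d → ℝ} (hz : Antitone z)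
    (I : Finset (Fin d)) :
    ∑ i ∈ I, z i ≤ ∑ k ∈ Finset.univ.filter (fun k : Fin d => (k : ℕ) < I.card), z k := by
  have hcard : I.card ≤ d := by simpa using I.card_le_univ
  rw [sum_filter_lt_eq_sum_range hcard (extendSeq_coe z), Finset.sum_range]
  have hI : ∑ i ∈ I, z i = ∑ i : Fin I.card, z (I.orderEmbOfFin rfl i) := by
    conv_lhs => rw [← Finset.map_orderEmbOfFin_univ I rfl, Finset.sum_map]
    rfl
  rw [hI]
  refine Finset.sum_le_sum fun i _ => ?_
  rw [extendSeq, dif_pos (i.2.trans_le hcard)]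
  exact hz (Fin.val_le_of_strictMono (I.orderEmbOfFin rfl).strictMono i)

lemma sourceSet_eq_sortedPart (n : ℕ) (lam : Fin (n + 2) → ℝ) (hnonneg : ∀ i, 0 ≤ lam i)
    (hsum : ∑ i, lam i = 1) {a : ℕ → ℝ} (ha : ∀ k : Fin (n + 2), a k = lam k) :
    sourceSet n lam = sortedPart (n + 1) a := by
  have hs : ∑ i ∈ Finset.range (n + 1 + 1), a i = 1 := by
    rw [Finset.sum_range, ← hsum]
    exact Finset.sum_congr rfl fun k _ => ha k
  have hext : ∀ y, extendProb n y = completion 1 y := fun y => rfl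
  ext y
  simp only [sourceSet, MajorizedBy, Set.mem_ofPred_eq, hext, sortedPart, Set.mem_inter_iff, hs]
  constructor
  · rintro ⟨hanti, -, hmaj⟩
    refine ⟨fun I => ?_, hanti⟩
    have hcard : I.card ≤ n + 2 := by simpa using I.card_le_univ
    rw [hs, ← sum_filter_lt_eq_sum_range hcard ha]
    exact (sum_le_sum_filter_of_antitone hanti I).trans (hmaj _ hcard)
  · rintro ⟨hP, hanti⟩
    refine ⟨hanti, fun i => ?_, fun m hm => ?_⟩
    · have := (completion_mem_Icc hP i).1
      rw [hs] at this
      exact ((hnonneg (Fin.last (n + 1))).trans_eq (ha (Fin.last (n + 1))).symm).trans this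
    · have h := hP (Finset.univ.filter fun k : Fin (n + 2) => (k : ℕ) < m)
      rw [hs] at h
      refine h.trans_eq ?_
      have hcard : (Finset.univ.filter fun k : Fin (n + 2) => (k : ℕ) < m).card = m := by
        rw [Fin.card_filter_val_lt, min_eq_right hm]
      rw [hcard, sum_filter_lt_eq_sum_range hm ha]

/-- the Lebesgue volume of the majorization polytope
`{y : y ≺ λ}` (the source set of a pure state with sorted vector `λ`, here
`d = n + 2`), projected to `ℝ^{d-1}`, is
`(1/(d!·(d−1)!)) Σ_{π∈S_d} (Σ_k π(k)λ_k − (d+1)/2)^{d−1} / Π_{k=1}^{d-1}(π(k)−π(k+1))`. -/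
theorem source_volume_formula (n : ℕ) (lam : Fin (n + 2) → ℝ)
    (hmono : Antitone lam) (hnonneg : ∀ i, 0 ≤ lam i)
    (hsum : ∑ i, lam i = 1) :
    volume (sourceSet n lam) =
      ENNReal.ofReal
        ((1 / ((Nat.factorial (n + 2) : ℝ) * (Nat.factorial (n + 1) : ℝ))) *
          ∑ π : Equiv.Perm (Fin (n + 2)),
            (∑ k, (((π k : ℕ) : ℝ) + 1) * lam k - ((n : ℝ) + 3) / 2) ^ (n + 1) /
              ∏ k : Fin (n + 1),
                (((π k.castSucc : ℕ) : ℝ) - ((π k.succ : ℕ) : ℝ))) := by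
  set a : ℕ → ℝ := fun i => lam ⟨min i (n + 1), by omega⟩ with ha_def
  have ha : ∀ k : Fin (n + 2), a k = lam k := by
    intro k
    simp only [ha_def]
    congr 1
    ext
    exact min_eq_left (Nat.lt_succ_iff.1 k.2)
  have hanti : Antitone a := fun i j hij => hmono (Fin.mk_le_mk.2 (min_le_min_right _ hij))
  set x : Fin (n + 2) → ℝ := fun k => ((k : ℕ) : ℝ) + 1 with hx_def
  have hx : Function.Injective x := fun i j h => Fin.ext (by simpa [hx_def] using h)
  have hterm : ∀ π : Equiv.Perm (Fin (n + 2)),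
      volumeTerm (n + 1) a (extendSeq (x ∘ π)) (-(((n : ℝ) + 3) / 2)) =
        (∑ k, (((π k : ℕ) : ℝ) + 1) * lam k - ((n : ℝ) + 3) / 2) ^ (n + 1) /
          ∏ k : Fin (n + 1), (((π k.castSucc : ℕ) : ℝ) - ((π k.succ : ℕ) : ℝ)) := by
    intro π
    rw [volumeTerm, Finset.sum_range, Finset.prod_range, ← sub_eq_add_neg]
    congr 1
    · congr 2
      refine Finset.sum_congr rfl fun k _ => ?_
      rw [extendSeq_coe, ha, mul_comm]
      rfl
    · refine Finset.prod_congr rfl fun k _ => ?_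
      rw [← Fin.val_castSucc k, extendSeq_coe, Fin.val_castSucc k, ← Fin.val_succ k, extendSeq_coe]
      simp [hx_def]
  have hvol := volume_permutohedron (n + 1) a hanti x hx (-(((n : ℝ) + 3) / 2))
  simp only [hterm] at hvol
  rw [measureReal_def, volume_permutohedron_eq_sortedPart, ENNReal.toReal_mul,
    ENNReal.toReal_natCast, ← sourceSet_eq_sortedPart n lam hnonneg hsum ha] at hvol
  have hfin : volume (sourceSet n lam) ≠ ⊤ := by
    rw [sourceSet_eq_sortedPart n lam hnonneg hsum ha]
    exact ne_top_of_le_ne_top (volume_permutohedron_ne_top (n + 1) a)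
      (measure_mono Set.inter_subset_left)
  rw [← ENNReal.ofReal_toReal hfin]
  congr 1
  have hfac : ((n + 1 + 1).factorial : ℝ) ≠ 0 := by positivity
  have hfac' : ((n + 1).factorial : ℝ) ≠ 0 := by positivity
  rw [eq_comm, ← mul_right_inj' hfac, hvol, ← mul_assoc]
  congr 1
  field_simp
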